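/- For any unimodular lattice Γ ⊂ ℝ^d, A > d, and ν > 0, sup_u Σ_{x ∈ Γ} (1 + ν|x − u|_∞)^{−A} ≤ C_A (ν^{−d} + λ₁(Γ^⊥)^{−d}), where Γ^⊥ is the dual lattice and λ₁ the first successive minimum for the sup norm. -/

import Mathlib

open scoped BigOperators

/-- The lattice in `ℝ^d` generated by the columns of the matrix `B`. -/
def latticePts (d : ℕ) (B : Matrix (Fin d) (Fin d) ℝ) : Set (Fin d → ℝ) :=
  {x | ∃ m : Fin d → ℤ, x = B.mulVec fun i => (m i : ℝ)}

/-- The dual lattice: all `y` with `x · y ∈ ℤ` for every lattice point `x`. -/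
def dualPts (d : ℕ) (B : Matrix (Fin d) (Fin d) ℝ) : Set (Fin d → ℝ) :=
  {y | ∀ x ∈ latticePts d B, ∃ k : ℤ, ∑ i, x i * y i = (k : ℝ)}

/-- The first successive minimum of the dual lattice, for the sup norm. -/
noncomputable def firstMinDual (d : ℕ) (B : Matrix (Fin d) (Fin d) ℝ) : ℝ :=
  sInf {t : ℝ | ∃ y ∈ dualPts d B, y ≠ 0 ∧ ‖y‖ ≤ t}

open MeasureTheory

/-- The exponential sum over a finite set of frequencies. -/
noncomputable def expSum {d : ℕ} (S : Finset (Fin d → ℤ)) (z : Fin d → ℝ) : ℂ :=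
  ∑ m ∈ S, Complex.exp (2 * Real.pi * Complex.I * ((∑ i, (m i : ℝ) * z i : ℝ) : ℂ))

lemma expSum_continuous {d : ℕ} (S : Finset (Fin d → ℤ)) : Continuous (expSum S) := by
  unfold expSum
  fun_prop

lemma int_exp_one (n : ℤ) :
    ∫ x in Set.Ico (0:ℝ) 1, Complex.exp (2 * Real.pi * Complex.I * n * (x : ℂ))
      = if n = 0 then 1 else 0 := by
  rw [integral_Ico_eq_integral_Ioc, ← intervalIntegral.integral_of_le zero_le_one]
  split_ifs with h
  · subst h; simp
  · rw [integral_exp_mul_complex]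
    · have : Complex.exp (2 * Real.pi * Complex.I * n * ((1:ℝ):ℂ)) = 1 := by
        rw [Complex.exp_eq_one_iff]
        exact ⟨n, by push_cast; ring⟩
      rw [this]; simp
    · have := Complex.two_pi_I_ne_zero
      exact mul_ne_zero this (by exact_mod_cast h)

lemma int_exp_cube {d : ℕ} (n : Fin d → ℤ) :
    ∫ z in Set.pi Set.univ (fun _ : Fin d => Set.Ico (0:ℝ) 1),
      Complex.exp (2 * Real.pi * Complex.I * ((∑ i, (n i : ℝ) * z i : ℝ) : ℂ))
      = if n = 0 then 1 else 0 := by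
  have h : ∀ z : Fin d → ℝ,
      Complex.exp (2 * Real.pi * Complex.I * ((∑ i, (n i : ℝ) * z i : ℝ) : ℂ))
      = ∏ i, Complex.exp (2 * Real.pi * Complex.I * (n i) * (z i : ℂ)) := by
    intro z
    rw [← Complex.exp_sum]
    congr 1
    push_cast
    rw [Finset.mul_sum]
    exact Finset.sum_congr rfl fun i _ => by ring
  simp_rw [h]
  rw [volume_pi, Measure.restrict_pi_pi,
    integral_fintype_prod_eq_prod
      (f := fun i (x : ℝ) => Complex.exp (2 * Real.pi * Complex.I * (n i) * (x : ℂ)))]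
  simp_rw [int_exp_one]
  split_ifs with h0
  · subst h0; simp
  · obtain ⟨i, hi⟩ := Function.ne_iff.mp h0
    exact Finset.prod_eq_zero (Finset.mem_univ i) (if_neg hi)

lemma cube_integrable {d : ℕ} {E : Type*} [NormedAddCommGroup E] (f : (Fin d → ℝ) → E) (hf : Continuous f) :
    IntegrableOn f (Set.pi Set.univ (fun _ : Fin d => Set.Ico (0:ℝ) 1)) := by
  have hc : IsCompact (Set.pi Set.univ (fun _ : Fin d => Set.Icc (0:ℝ) 1)) :=
    isCompact_univ_pi fun _ => isCompact_Icc
  exact (hf.continuousOn.integrableOn_compact hc).mono_set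
    (Set.pi_mono fun _ _ => Set.Ico_subset_Icc_self)

lemma expSum_sq {d : ℕ} (S : Finset (Fin d → ℤ)) (z : Fin d → ℝ) :
    ((‖expSum S z‖ ^ 2 : ℝ) : ℂ) = ∑ m ∈ S, ∑ n ∈ S,
      Complex.exp (2 * Real.pi * Complex.I * ((∑ i, ((m - n) i : ℝ) * z i : ℝ) : ℂ)) := by
  push_cast
  rw [← Complex.mul_conj', expSum, map_sum, Finset.sum_mul_sum]
  refine Finset.sum_congr rfl fun m _ => Finset.sum_congr rfl fun n _ => ?_
  rw [← Complex.exp_conj, ← Complex.exp_add]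
  congr 1
  simp only [map_mul, Complex.conj_I, Complex.conj_ofReal, map_ofNat]
  have : (∑ i, ((m i : ℝ) - (n i : ℝ)) * z i) = (∑ i, (m i : ℝ) * z i) - ∑ i, (n i : ℝ) * z i := by
    rw [← Finset.sum_sub_distrib]
    exact Finset.sum_congr rfl fun i _ => by ring
  simp only [Pi.sub_apply, Int.cast_sub]
  have thisC := congrArg Complex.ofReal this
  push_cast at thisC ⊢
  rw [thisC]
  ring

lemma expSum_cube {d : ℕ} (S : Finset (Fin d → ℤ)) :
    ∫⁻ z in Set.pi Set.univ (fun _ : Fin d => Set.Ico (0:ℝ) 1), ‖expSum S z‖ₑ ^ 2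
      = (S.card : ENNReal) := by
  have h1 : ∫ z in Set.pi Set.univ (fun _ : Fin d => Set.Ico (0:ℝ) 1), ‖expSum S z‖ ^ 2
      = (S.card : ℝ) := by
    have : ((∫ z in Set.pi Set.univ (fun _ : Fin d => Set.Ico (0:ℝ) 1), ‖expSum S z‖ ^ 2 : ℝ) : ℂ)
      = (S.card : ℂ) := by
      rw [← integral_complex_ofReal]
      simp_rw [expSum_sq]
      rw [integral_finsetSum]
      · have : ∀ m ∈ S, ∫ z in Set.pi Set.univ (fun _ : Fin d => Set.Ico (0:ℝ) 1), ∑ n ∈ S,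
            Complex.exp (2 * Real.pi * Complex.I * ((∑ i, ((m - n) i : ℝ) * z i : ℝ) : ℂ)) = 1 := by
          intro m hm
          rw [integral_finsetSum]
          · have h2 := fun n => int_exp_cube (m - n)
            simp_rw [h2, sub_eq_zero]
            simp [hm]
          · intro n _
            exact cube_integrable _ (by fun_prop)
        rw [Finset.sum_congr rfl this]
        simp
      · intro m _
        exact cube_integrable _ (by fun_prop)
    exact_mod_cast this
  have h2 := ofReal_integral_eq_lintegral_ofReal
    (cube_integrable (d := d) (fun z => ‖expSum S z‖ ^ 2) ((expSum_continuous S).norm.pow 2))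
    (Filter.Eventually.of_forall fun z => by positivity)
  rw [h1] at h2
  rw [ENNReal.ofReal_natCast] at h2
  rw [h2]
  refine lintegral_congr fun z => ?_
  rw [ENNReal.ofReal_pow (norm_nonneg _), ofReal_norm]

lemma expSum_periodic {d : ℕ} (S : Finset (Fin d → ℤ)) (z : Fin d → ℝ) (k : Fin d → ℤ) :
    expSum S ((fun i => (k i : ℝ)) + z) = expSum S z := by
  unfold expSum
  refine Finset.sum_congr rfl fun m _ => ?_
  rw [Complex.exp_eq_exp_iff_exists_int]
  refine ⟨∑ i, m i * k i, ?_⟩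
  simp only [Pi.add_apply, mul_add, Finset.sum_add_distrib]
  push_cast
  ring

lemma expSum_pack {d : ℕ} (S : Finset (Fin d → ℤ)) (Q : Set (Fin d → ℝ)) (hQ : MeasurableSet Q)
    (hinj : ∀ z ∈ Q, ∀ w ∈ Q, (∃ k : Fin d → ℤ, z - w = fun i => (k i : ℝ)) → z = w) :
    ∫⁻ z in Q, ‖expSum S z‖ₑ ^ 2 ≤ (S.card : ENNReal) := by
  have hF : IsAddFundamentalDomain
      (Submodule.span ℤ (Set.range (Pi.basisFun ℝ (Fin d)))).toAddSubgroup
      (ZSpan.fundamentalDomain (Pi.basisFun ℝ (Fin d))) (volume : Measure (Fin d → ℝ)) :=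
    ZSpan.isAddFundamentalDomain' _ _
  have hint : ∀ g : (Submodule.span ℤ (Set.range (Pi.basisFun ℝ (Fin d)))).toAddSubgroup,
      ∃ k : Fin d → ℤ, (g : Fin d → ℝ) = fun i => (k i : ℝ) := by
    intro g
    have := ((Pi.basisFun ℝ (Fin d)).mem_span_iff_repr_mem ℤ (g : Fin d → ℝ)).1 g.2
    choose k hk using this
    refine ⟨k, funext fun i => ?_⟩
    simpa using (hk i).symm
  have hcount : Countable (Submodule.span ℤ (Set.range (Pi.basisFun ℝ (Fin d)))).toAddSubgroup :=
    inferInstanceAs (Countable (Submodule.span ℤ (Set.range (Pi.basisFun ℝ (Fin d)))))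
  rw [← lintegral_indicator hQ, hF.lintegral_eq_tsum'']
  rw [← expSum_cube S, ← ZSpan.fundamentalDomain_pi_basisFun]
  rw [← lintegral_tsum]
  · refine lintegral_mono fun z => ?_
    by_cases hz : ∃ g : (Submodule.span ℤ (Set.range (Pi.basisFun ℝ (Fin d)))).toAddSubgroup,
      g +ᵥ z ∈ Q
    · obtain ⟨g, hg⟩ := hz
      rw [tsum_eq_single g]
      · rw [Set.indicator_of_mem hg]
        obtain ⟨k, hk⟩ := hint g
        have : g +ᵥ z = (fun i => (k i : ℝ)) + z := by
          rw [← hk]; rfl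
        rw [this, expSum_periodic]
      · intro g' hne
        refine Set.indicator_of_notMem (fun hg' => hne ?_) _
        have := hinj _ hg' _ hg ?_
        · have h3 : (g' : Fin d → ℝ) + z = g + z := this
          exact Subtype.ext (add_right_cancel h3)
        · obtain ⟨k, hk⟩ := hint (g' - g)
          refine ⟨k, ?_⟩
          rw [← hk]
          change ((g' : Fin d → ℝ) + z) - (g + z) = g' - g
          abel
    · push Not at hz
      simp [Set.indicator_of_notMem (hz _)]
  · intro g
    refine Measurable.aemeasurable ?_
    have hm : Measurable (fun z : Fin d → ℝ => g +ᵥ z) :=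
      (measurable_const_add (g : Fin d → ℝ))
    exact (((expSum_continuous S).enorm.measurable.pow_const 2).indicator hQ).comp hm

lemma firstMinDual_le {d : ℕ} (B : Matrix (Fin d) (Fin d) ℝ) (y : Fin d → ℝ)
    (hy : y ∈ dualPts d B) (h0 : y ≠ 0) : firstMinDual d B ≤ ‖y‖ := by
  refine csInf_le ⟨0, ?_⟩ ⟨y, hy, h0, le_rfl⟩
  rintro t ⟨y, _, _, h⟩
  exact (norm_nonneg y).trans h

lemma mem_dual_of_int {d : ℕ} (B : Matrix (Fin d) (Fin d) ℝ) (y : Fin d → ℝ) (k : Fin d → ℤ)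
    (hk : B.transpose.mulVec y = fun i => (k i : ℝ)) : y ∈ dualPts d B := by
  rintro x ⟨m, rfl⟩
  refine ⟨∑ i, m i * k i, ?_⟩
  change (B.mulVec fun i => (m i : ℝ)) ⬝ᵥ y = _
  rw [dotProduct_comm, Matrix.dotProduct_mulVec, ← Matrix.mulVec_transpose, hk]
  simp [dotProduct, mul_comm]

lemma firstMinDual_pos {d : ℕ} (hd : 0 < d) (B : Matrix (Fin d) (Fin d) ℝ) (hB : |B.det| = 1) :
    0 < firstMinDual d B := by
  have hu : IsUnit B.transpose.det := by
    rw [Matrix.det_transpose, isUnit_iff_ne_zero]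
    intro h; simp [h] at hB
  have hne : ({t : ℝ | ∃ y ∈ dualPts d B, y ≠ 0 ∧ ‖y‖ ≤ t}).Nonempty := by
    set y := (B.transpose)⁻¹.mulVec (fun _ => 1) with hy
    have h1 : B.transpose.mulVec y = fun i => (((fun _ => 1 : Fin d → ℤ) i : ℤ) : ℝ) := by
      rw [hy, Matrix.mulVec_mulVec, Matrix.mul_nonsing_inv _ hu, Matrix.one_mulVec]
      simp
    refine ⟨‖y‖, y, mem_dual_of_int B y _ h1, ?_, le_rfl⟩
    intro h
    rw [h, Matrix.mulVec_zero] at h1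
    have := congrFun h1 ⟨0, hd⟩
    simp at this
  set K : ℝ := 1 + ∑ i, ∑ j, |B j i| with hK
  have hKpos : 0 < K := by positivity
  have : 1 / K ≤ firstMinDual d B := by
    refine le_csInf hne ?_
    rintro t ⟨y, hy, h0, hyt⟩
    refine le_trans ?_ hyt
    have hex : ∃ i, B.transpose.mulVec y i ≠ 0 := by
      by_contra! hcon
      apply h0
      have h2 : B.transpose.mulVec y = 0 := funext hcon
      have h3 : (B.transpose)⁻¹.mulVec (B.transpose.mulVec y) = y := by
        rw [Matrix.mulVec_mulVec, Matrix.nonsing_inv_mul _ hu, Matrix.one_mulVec]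
      rw [← h3, h2, Matrix.mulVec_zero]
    obtain ⟨i, hi⟩ := hex
    obtain ⟨k, hk⟩ := hy (B.mulVec fun j => ((Pi.single i 1 : Fin d → ℤ) j : ℝ)) ⟨_, rfl⟩
    have hs : (fun j => ((Pi.single i 1 : Fin d → ℤ) j : ℝ)) = Pi.single i 1 := by
      ext j; by_cases h : j = i
      · subst h; simp
      · simp [h]
    have hk2 : B.transpose.mulVec y i = k := by
      rw [← hk, hs, Matrix.mulVec_single_one]
      simp [Matrix.mulVec, dotProduct]
    have h1 : 1 ≤ |B.transpose.mulVec y i| := by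
      rw [hk2] at hi ⊢
      have : k ≠ 0 := by exact_mod_cast hi
      exact_mod_cast Int.one_le_abs this
    have h2 : |B.transpose.mulVec y i| ≤ K * ‖y‖ := by
      calc |B.transpose.mulVec y i| ≤ ∑ j, |B j i * y j| := by
            simp only [Matrix.mulVec, dotProduct, Matrix.transpose_apply]
            exact Finset.abs_sum_le_sum_abs _ _
        _ ≤ ∑ j, |B j i| * ‖y‖ := by
            refine Finset.sum_le_sum fun j _ => ?_
            rw [abs_mul]
            exact mul_le_mul_of_nonneg_left (norm_le_pi_norm y j) (abs_nonneg _)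
        _ = (∑ j, |B j i|) * ‖y‖ := by rw [Finset.sum_mul]
        _ ≤ K * ‖y‖ := by
            refine mul_le_mul_of_nonneg_right ?_ (norm_nonneg _)
            have := Finset.single_le_sum (f := fun i => ∑ j, |B j i|)
              (fun i _ => Finset.sum_nonneg fun j _ => abs_nonneg _) (Finset.mem_univ i)
            linarith
    rw [div_le_iff₀ hKpos]
    linarith
  exact lt_of_lt_of_le (by positivity) this

lemma cos_ge_half (t : ℝ) (ht : |t| ≤ 1 / 6) : 1 / 2 ≤ Real.cos (2 * Real.pi * t) := by
  rw [← Real.cos_pi_div_three, ← Real.cos_abs (2 * Real.pi * t)]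
  have hpi := Real.pi_pos
  apply Real.cos_le_cos_of_nonneg_of_le_pi (abs_nonneg _) (by linarith)
  rw [abs_mul, abs_of_pos (by positivity : 0 < 2 * Real.pi)]
  nlinarith

lemma expSum_lower {d : ℕ} (hd : 0 < d) (B : Matrix (Fin d) (Fin d) ℝ) (u y : Fin d → ℝ) (ρ : ℝ)
    (hρ : 0 < ρ) (S : Finset (Fin d → ℤ))
    (hS : ∀ m ∈ S, ‖(B.mulVec fun i => (m i : ℝ)) - u‖ ≤ ρ)
    (hy : ‖y‖ ≤ 1 / (6 * d * ρ)) :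
    (S.card : ℝ) / 2 ≤ ‖expSum S (B.transpose.mulVec y)‖ := by
  have hd' : (0:ℝ) < d := by exact_mod_cast hd
  set c : ℂ := Complex.exp (((-(2 * Real.pi * (u ⬝ᵥ y)) : ℝ) : ℂ) * Complex.I) with hc
  have hcn : ‖c‖ = 1 := Complex.norm_exp_ofReal_mul_I _
  have key : expSum S (B.transpose.mulVec y) * c = ∑ m ∈ S,
      Complex.exp (((2 * Real.pi * (((B.mulVec fun i => (m i : ℝ)) - u) ⬝ᵥ y) : ℝ) : ℂ)
        * Complex.I) := by
    rw [expSum, Finset.sum_mul]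
    refine Finset.sum_congr rfl fun m _ => ?_
    rw [hc, ← Complex.exp_add]
    congr 1
    have : (∑ i, (m i : ℝ) * B.transpose.mulVec y i) = (B.mulVec fun i => (m i : ℝ)) ⬝ᵥ y := by
      rw [dotProduct_comm (B.mulVec _), Matrix.dotProduct_mulVec, ← Matrix.mulVec_transpose,
        dotProduct_comm]
      rfl
    rw [this, sub_dotProduct]
    push_cast
    ring
  have h1 : ‖expSum S (B.transpose.mulVec y)‖ = ‖expSum S (B.transpose.mulVec y) * c‖ := by
    rw [norm_mul, hcn, mul_one]
  rw [h1, key]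
  refine le_trans ?_ (Complex.re_le_norm _)
  rw [Complex.re_sum]
  have h2 : ∀ m ∈ S, 1 / 2 ≤ (Complex.exp (((2 * Real.pi *
      (((B.mulVec fun i => (m i : ℝ)) - u) ⬝ᵥ y) : ℝ) : ℂ) * Complex.I)).re := by
    intro m hm
    rw [Complex.exp_ofReal_mul_I_re]
    apply cos_ge_half
    calc |((B.mulVec fun i => (m i : ℝ)) - u) ⬝ᵥ y|
        ≤ ∑ i, |((B.mulVec fun i => (m i : ℝ)) - u) i * y i| := Finset.abs_sum_le_sum_abs _ _
      _ ≤ ∑ i : Fin d, ρ * (1 / (6 * d * ρ)) := by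
          refine Finset.sum_le_sum fun i _ => ?_
          rw [abs_mul]
          exact mul_le_mul ((norm_le_pi_norm _ i).trans (hS m hm))
            ((norm_le_pi_norm y i).trans hy) (abs_nonneg _) hρ.le
      _ = 1 / 6 := by
          simp
          field_simp
  calc (S.card : ℝ) / 2 = ∑ m ∈ S, (1 / 2 : ℝ) := by simp; ring
    _ ≤ _ := Finset.sum_le_sum h2

lemma count_bound {d : ℕ} (hd : 0 < d) (B : Matrix (Fin d) (Fin d) ℝ) (hB : |B.det| = 1)
    (u : Fin d → ℝ) (ρ : ℝ) (hρ : 0 < ρ) (hl : 1 ≤ ρ * firstMinDual d B)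
    (S : Finset (Fin d → ℤ)) (hS : ∀ m ∈ S, ‖(B.mulVec fun i => (m i : ℝ)) - u‖ ≤ ρ) :
    (S.card : ℝ) ≤ 4 * (3 * d * ρ) ^ d := by
  have hd' : (0:ℝ) < d := by exact_mod_cast hd
  have hd1 : (1:ℝ) ≤ d := by exact_mod_cast hd
  have hu : IsUnit B.transpose.det := by
    rw [Matrix.det_transpose, isUnit_iff_ne_zero]
    intro h; simp [h] at hB
  set M := (B.transpose)⁻¹ with hM
  have hMdet : |M.det| = 1 := by
    rw [hM, Matrix.det_nonsing_inv, Ring.inverse_eq_inv', Matrix.det_transpose, abs_inv, hB, inv_one]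
  have hM0 : M.det ≠ 0 := by
    intro h; simp [h] at hMdet
  have hBM : ∀ z, B.transpose.mulVec (M.mulVec z) = z := fun z => by
    rw [Matrix.mulVec_mulVec, Matrix.mul_nonsing_inv _ hu, Matrix.one_mulVec]
  set h : ℝ := 1 / (6 * d * ρ) with hh
  have hpos : 0 < h := by positivity
  set Q : Set (Fin d → ℝ) := (Matrix.toLin' M) ⁻¹' (Metric.ball 0 h) with hQ
  have hcont : Continuous (Matrix.toLin' M) := LinearMap.continuous_of_finiteDimensional _
  have hQm : MeasurableSet Q := hcont.measurable Metric.isOpen_ball.measurableSet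
  have hvol : volume Q = ENNReal.ofReal ((2 * h) ^ d) := by
    have h1 := Real.map_matrix_volume_pi_eq_smul_volume_pi hM0
    have h2 : volume Q = (Measure.map (Matrix.toLin' M) volume) (Metric.ball 0 h) := by
      rw [Measure.map_apply hcont.measurable Metric.isOpen_ball.measurableSet]
    rw [h2, h1, abs_inv, hMdet]
    simp [Real.volume_pi_ball _ hpos]
  have hpack := expSum_pack S Q hQm ?_
  · have hlow : ∫⁻ z in Q, ENNReal.ofReal (((S.card : ℝ) / 2) ^ 2) ≤
        ∫⁻ z in Q, ‖expSum S z‖ₑ ^ 2 := by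
      refine setLIntegral_mono' hQm fun z hz => ?_
      have hz' : ‖M.mulVec z‖ < h := by simpa [hQ] using hz
      have := expSum_lower hd B u (M.mulVec z) ρ hρ S hS hz'.le
      rw [hBM] at this
      rw [← ofReal_norm, ← ENNReal.ofReal_pow (norm_nonneg _)]
      exact ENNReal.ofReal_le_ofReal (pow_le_pow_left₀ (by positivity) this 2)
    have h3 := hlow.trans hpack
    rw [setLIntegral_const, hvol, ← ENNReal.ofReal_mul (by positivity), ← ENNReal.ofReal_natCast,
      ENNReal.ofReal_le_ofReal_iff (by positivity)] at h3
    have h4 : (2 * h) ^ d * (3 * d * ρ) ^ d = 1 := by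
      rw [← mul_pow, hh]
      have : 2 * (1 / (6 * d * ρ)) * (3 * d * ρ) = 1 := by field_simp; norm_num
      rw [this, one_pow]
    have hX : 0 < (3 * d * ρ) ^ d := by positivity
    rcases Nat.eq_zero_or_pos S.card with h0 | h0
    · rw [h0]; simp only [Nat.cast_zero]; positivity
    · have h0' : (0:ℝ) < S.card := by exact_mod_cast h0
      have h5 := mul_le_mul_of_nonneg_right h3 hX.le
      rw [mul_assoc, h4, mul_one] at h5
      nlinarith
  · rintro z hz w hw ⟨k, hk⟩
    have hz' : ‖M.mulVec z‖ < h := by simpa [hQ] using hz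
    have hw' : ‖M.mulVec w‖ < h := by simpa [hQ] using hw
    have hlt : ‖M.mulVec (z - w)‖ < 2 * h := by
      rw [Matrix.mulVec_sub]
      linarith [norm_sub_le (M.mulVec z) (M.mulVec w)]
    have hmem : M.mulVec (z - w) ∈ dualPts d B := mem_dual_of_int B _ k (by rw [hBM, hk])
    by_contra hne
    have h0 : M.mulVec (z - w) ≠ 0 := by
      intro h0
      have := hBM (z - w)
      rw [h0, Matrix.mulVec_zero] at this
      exact hne (sub_eq_zero.1 this.symm)
    have h6 := firstMinDual_le B _ hmem h0
    have h7 : 1 / ρ ≤ firstMinDual d B := by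
      rw [div_le_iff₀ hρ]; linarith
    have h8 : 2 * h ≤ 1 / ρ := by
      rw [hh, ← mul_div_assoc, div_le_div_iff₀ (by positivity) hρ]
      nlinarith
    linarith

lemma rpow_sum_bound {d : ℕ} (hd : 0 < d) (A : ℝ) (hA : (d : ℝ) < A)
    (B : Matrix (Fin d) (Fin d) ℝ) (hB : |B.det| = 1)
    (u : Fin d → ℝ) (R : ℝ) (hR : 0 < R) (hl : 1 ≤ R * firstMinDual d B)
    (S : Finset (Fin d → ℤ)) :
    ∑ m ∈ S, (1 + ‖(B.mulVec fun i => (m i : ℝ)) - u‖ / R) ^ (-A)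
      ≤ (4 * (6 * d) ^ d * (1 - (2:ℝ) ^ ((d:ℝ) - A))⁻¹) * R ^ d := by
  set r : ℝ := (2:ℝ) ^ ((d:ℝ) - A) with hr
  have hr0 : 0 < r := by positivity
  have hr1 : r < 1 := Real.rpow_lt_one_of_one_lt_of_neg (by norm_num) (by linarith)
  have hex : ∀ m : Fin d → ℤ, ∃ j : ℕ,
      (2:ℝ) ^ j ≤ 1 + ‖(B.mulVec fun i => (m i : ℝ)) - u‖ / R ∧
        1 + ‖(B.mulVec fun i => (m i : ℝ)) - u‖ / R < 2 ^ (j + 1) := fun m =>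
    exists_nat_pow_near (le_add_of_nonneg_right (by positivity)) (by norm_num)
  choose j hj1 hj2 using hex
  rw [← Finset.sum_fiberwise_of_maps_to (g := j) (t := S.image j)
    (fun m hm => Finset.mem_image_of_mem j hm)]
  have hfib : ∀ k ∈ S.image j, ∑ m ∈ S with j m = k,
      (1 + ‖(B.mulVec fun i => (m i : ℝ)) - u‖ / R) ^ (-A)
        ≤ (4 * (6 * d) ^ d * R ^ d) * r ^ k := by
    intro k _
    have hcard := count_bound hd B hB u (2 ^ (k + 1) * R) (by positivity)
      (by
        have : (1:ℝ) ≤ 2 ^ (k + 1) := one_le_pow₀ (by norm_num)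
        rw [mul_assoc]; nlinarith) (S.filter fun m => j m = k) (by
        intro m hm
        have hjm := (Finset.mem_filter.1 hm).2
        have := hj2 m
        rw [hjm] at this
        rw [← div_le_iff₀ hR]
        linarith)
    calc _ ≤ ∑ m ∈ S with j m = k, ((2:ℝ) ^ k) ^ (-A) := by
          refine Finset.sum_le_sum fun m hm => ?_
          have hjm := (Finset.mem_filter.1 hm).2
          have := hj1 m
          rw [hjm] at this
          exact Real.rpow_le_rpow_of_nonpos (by positivity) this
            (by have : (0:ℝ) < d := by exact_mod_cast hd
                linarith)
      _ = ((S.filter fun m => j m = k).card : ℝ) * ((2:ℝ) ^ k) ^ (-A) := by simp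
      _ ≤ (4 * (3 * d * (2 ^ (k + 1) * R)) ^ d) * ((2:ℝ) ^ k) ^ (-A) :=
          mul_le_mul_of_nonneg_right hcard (by positivity)
      _ = _ := by
          have e1 : r ^ k = ((2:ℝ) ^ k) ^ d * ((2:ℝ) ^ k) ^ (-A) := by
            rw [hr, ← Real.rpow_natCast ((2:ℝ)^k) d, ← Real.rpow_add (by positivity),
              ← Real.rpow_natCast, ← Real.rpow_natCast, ← Real.rpow_mul (by norm_num),
              ← Real.rpow_mul (by norm_num)]
            congr 1; ring
          have e2 : (3 * d * (2 ^ (k + 1) * R)) = (6 * d) * R * (2:ℝ) ^ k := by ring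
          rw [e1, e2, mul_pow, mul_pow]
          ring
  refine (Finset.sum_le_sum hfib).trans ?_
  rw [← Finset.mul_sum]
  have hg : ∑ k ∈ S.image j, r ^ k ≤ (1 - r)⁻¹ := by
    rw [← tsum_geometric_of_lt_one hr0.le hr1]
    exact (summable_geometric_of_lt_one hr0.le hr1).sum_le_tsum _ (fun _ _ => by positivity)
  calc _ ≤ (4 * (6 * d) ^ d * R ^ d) * (1 - r)⁻¹ :=
        mul_le_mul_of_nonneg_left hg (by positivity)
    _ = _ := by ring

/-- For a unimodular lattice `Γ ⊂ ℝ^d`, `A > d` and `ν > 0`,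
`sup_u Σ_{x ∈ Γ} (1 + ν |x - u|_∞)^{-A} ≤ C_A (ν^{-d} + λ₁(Γ^⊥)^{-d})`. -/
theorem elementary_lattice_sum_bound_dual (d : ℕ) (hd : 0 < d) (A : ℝ)
    (hA : (d : ℝ) < A) :
    ∃ C : ℝ, 0 < C ∧ ∀ B : Matrix (Fin d) (Fin d) ℝ, |B.det| = 1 →
      ∀ ν : ℝ, 0 < ν → ∀ u : Fin d → ℝ,
        ∑' m : Fin d → ℤ,
            (1 + ν * ‖(B.mulVec fun i => (m i : ℝ)) - u‖) ^ (-A)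
          ≤ C * (ν ^ (-(d : ℝ)) + (firstMinDual d B) ^ (-(d : ℝ))) := by
  have hd' : (0:ℝ) < d := by exact_mod_cast hd
  have hr1 : (2:ℝ) ^ ((d:ℝ) - A) < 1 :=
    Real.rpow_lt_one_of_one_lt_of_neg (by norm_num) (by linarith)
  have hr2 : 0 < (1 - (2:ℝ) ^ ((d:ℝ) - A))⁻¹ := inv_pos.2 (by linarith)
  have hC : 0 < 4 * (6 * (d:ℝ)) ^ d * (1 - (2:ℝ) ^ ((d:ℝ) - A))⁻¹ := by positivity
  refine ⟨_, hC, fun B hB ν hν u => ?_⟩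
  have hl := firstMinDual_pos hd B hB
  set lam := firstMinDual d B with hlam
  set R : ℝ := max (1 / ν) (1 / lam) with hRdef
  have hR : 0 < R := lt_of_lt_of_le (by positivity) (le_max_left _ _)
  have hRl : 1 ≤ R * lam := by
    rw [← div_le_iff₀ hl]; exact le_max_right _ _
  have hRν : 1 ≤ R * ν := by
    rw [← div_le_iff₀ hν]; exact le_max_left _ _
  have hRd : R ^ d ≤ ν ^ (-(d : ℝ)) + lam ^ (-(d : ℝ)) := by
    have e : ∀ x : ℝ, 0 < x → (1 / x) ^ d = x ^ (-(d:ℝ)) := fun x hx => by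
      rw [Real.rpow_neg hx.le, Real.rpow_natCast, one_div, inv_pow]
    have p1 : 0 < ν ^ (-(d : ℝ)) := by positivity
    have p2 : 0 < lam ^ (-(d : ℝ)) := by positivity
    rcases max_choice (1 / ν) (1 / lam) with h | h
    · rw [hRdef, h, e ν hν]; linarith
    · rw [hRdef, h, e lam hl]; linarith
  refine Real.tsum_le_of_sum_le (fun m => by positivity) fun S => ?_
  refine le_trans (Finset.sum_le_sum fun m _ => ?_)
    ((rpow_sum_bound hd A hA B hB u R hR hRl S).trans (mul_le_mul_of_nonneg_left hRd hC.le))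
  refine Real.rpow_le_rpow_of_nonpos (by positivity) ?_ (by linarith)
  gcongr
  rw [div_le_iff₀ hR]
  nlinarith [norm_nonneg ((B.mulVec fun i => (m i : ℝ)) - u)]
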